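/- Let α be a positive integer and let M be a real number such that γ_n := 1 + M·n(n+1)⋯(n+α−1) ≠ 0 for every integer n ≥ 1 (note n(n+1)⋯(n+α−1) = Γ(n+α)/Γ(n)). Define β_n = −γ_{n+1}/γ_n for n ≥ 1 and the polynomials q_0 = 1, q_n = L_n^α + β_n·L_{n−1}^α for n ≥ 1 (these are the orthogonal polynomials with respect to the Krall–Laguerre–Koornwinder measure αΓ(α)²M·δ_0 + x^{α−1}e^{−x} on (0,∞)). Set λ_n = n + (M/(α+1))·n(n+1)⋯(n+α), P₁(x) = −x + (M/(α+1))·(−x)(−x+1)⋯(−x+α), P₂(x) = 1 + M·(−x+1)(−x+2)⋯(−x+α), and D = P₁(D_α) + (d/dx) ∘ P₂(D_α). Then D(q_n) = λ_n·q_n for all n ≥ 0; in particular, the q_n are common eigenfunctions of a differential operator of order 2α+2. -/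

import Mathlib

open Polynomial

/-- The Pochhammer symbol `(y)_j = y(y+1)⋯(y+j-1)` for a real `y`. -/
noncomputable def poch (y : ℝ) (j : ℕ) : ℝ := ∏ i ∈ Finset.range j, (y + i)

/-- The Laguerre polynomial `L_n^α(x) = ∑_{j=0}^n ((-x)^j/j!) binom(n+α, n-j)`,
where `binom(n+α, n-j) = (α+j+1)_{n-j}/(n-j)!`. -/
noncomputable def laguerre (α : ℝ) (n : ℕ) : ℝ[X] :=
  ∑ j ∈ Finset.range (n+1),
    C (poch (α + j + 1) (n-j) / (((n-j).factorial : ℝ) * (j.factorial : ℝ))) * (-X)^j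

theorem poch_succ_right (y : ℝ) (m : ℕ) : poch y (m + 1) = poch y m * (y + m) := by
  simp [poch, Finset.prod_range_succ]

theorem poch_succ_left (y : ℝ) (m : ℕ) : poch y (m + 1) = y * poch (y + 1) m := by
  simp only [poch, Finset.prod_range_succ', Nat.cast_zero, add_zero, Nat.cast_add, Nat.cast_one]
  rw [mul_comm]
  congr 1
  exact Finset.prod_congr rfl fun i _ => by ring

theorem coeff_laguerre (α : ℝ) (n k : ℕ) :
    (laguerre α n).coeff k = if k ≤ n then
      poch (α + k + 1) (n - k) / (((n - k).factorial : ℝ) * (k.factorial : ℝ)) * (-1) ^ k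
    else 0 := by
  have h (j : ℕ) : ((-X : ℝ[X]) ^ j) = C ((-1) ^ j) * X ^ j := by
    rw [neg_pow]; simp
  simp only [laguerre, finsetSum_coeff, h, ← mul_assoc, ← C_mul, coeff_C_mul_X_pow,
    Finset.sum_ite_eq, Finset.mem_range, Nat.lt_succ_iff]

theorem coeff_laguerre_of_lt {n k : ℕ} (α : ℝ) (h : n < k) : (laguerre α n).coeff k = 0 := by
  rw [coeff_laguerre, if_neg (by omega)]

theorem coeff_laguerre_add (α : ℝ) (k m : ℕ) :
    (laguerre α (k + m)).coeff k =
      poch (α + k + 1) m / ((m.factorial : ℝ) * (k.factorial : ℝ)) * (-1) ^ k := by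
  rw [coeff_laguerre, if_pos (by omega), Nat.add_sub_cancel_left]

theorem laguerre_zero (α : ℝ) : laguerre α 0 = 1 := by
  simp [laguerre, poch]

theorem coeff_laguerre_succ (α : ℝ) (n k : ℕ) :
    ((k : ℝ) + 1) * (α + k + 1) * (laguerre α n).coeff (k + 1) =
      ((k : ℝ) - n) * (laguerre α n).coeff k := by
  rcases lt_trichotomy n k with h | rfl | h
  · rw [coeff_laguerre_of_lt α h, coeff_laguerre_of_lt α (by omega)]; simp
  · rw [coeff_laguerre_of_lt α (Nat.lt_succ_self n)]; simp
  · obtain ⟨m, rfl⟩ := Nat.exists_eq_add_of_lt h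
    have h₁ := coeff_laguerre_add α (k + 1) m
    rw [show k + 1 + m = k + m + 1 by ring] at h₁
    have h₂ := coeff_laguerre_add α k (m + 1)
    rw [← add_assoc] at h₂
    rw [h₁, h₂, poch_succ_left, Nat.factorial_succ, Nat.factorial_succ,
      show α + ((k + 1 : ℕ) : ℝ) + 1 = α + k + 1 + 1 by push_cast; ring]
    have := Nat.factorial_ne_zero k
    have := Nat.factorial_ne_zero m
    push_cast
    field_simp
    ring

theorem laguerre_differential_equation (α : ℝ) (n : ℕ) :
    X * derivative (derivative (laguerre α n)) + (C (α + 1) - X) * derivative (laguerre α n) =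
      (-(n : ℝ)) • laguerre α n := by
  ext k
  have h := coeff_laguerre_succ α n k
  rw [sub_mul, coeff_add, coeff_sub, coeff_C_mul, coeff_smul, smul_eq_mul]
  cases k with
  | zero =>
    simp only [coeff_X_mul_zero, coeff_derivative]
    push_cast at h ⊢
    linear_combination h
  | succ k =>
    simp only [coeff_X_mul, coeff_derivative]
    push_cast at h ⊢
    linear_combination h

theorem derivative_laguerre_succ (α : ℝ) (n : ℕ) :
    derivative (laguerre α (n + 1)) = derivative (laguerre α n) - laguerre α n := by
  ext k
  rw [coeff_sub, coeff_derivative, coeff_derivative]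
  rcases lt_trichotomy n k with h | rfl | h
  · rw [coeff_laguerre_of_lt α h, coeff_laguerre_of_lt α (by omega),
      coeff_laguerre_of_lt α (by omega)]; simp
  · have h₁ := coeff_laguerre_add α (n + 1) 0
    have h₂ := coeff_laguerre_add α n 0
    rw [add_zero] at h₁ h₂
    rw [coeff_laguerre_of_lt α (Nat.lt_succ_self n), h₁, h₂, Nat.factorial_succ]
    have := Nat.factorial_ne_zero n
    simp only [poch, Finset.range_zero, Finset.prod_empty]
    push_cast
    field_simp
    ring
  · obtain ⟨m, rfl⟩ := Nat.exists_eq_add_of_lt h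
    have h₁ := coeff_laguerre_add α (k + 1) m
    have h₂ := coeff_laguerre_add α k (m + 1)
    have h₃ := coeff_laguerre_add α (k + 1) (m + 1)
    rw [show k + 1 + m = k + m + 1 by ring] at h₁
    rw [← add_assoc] at h₂
    rw [show k + 1 + (m + 1) = k + m + 1 + 1 by ring] at h₃
    rw [h₁, h₂, h₃, poch_succ_left (α + k + 1), poch_succ_right, Nat.factorial_succ,
      Nat.factorial_succ, show α + ((k + 1 : ℕ) : ℝ) + 1 = α + k + 1 + 1 by push_cast; ring]
    have := Nat.factorial_ne_zero k
    have := Nat.factorial_ne_zero m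
    push_cast
    field_simp
    ring

theorem prod_range_add_succ_sub (y : ℝ) (m : ℕ) :
    ∏ i ∈ Finset.range (m + 1), (y + 1 + i) - ∏ i ∈ Finset.range (m + 1), (y + i) =
      (m + 1) * ∏ i ∈ Finset.range m, (y + 1 + i) := by
  change poch (y + 1) (m + 1) - poch y (m + 1) = (m + 1) * poch (y + 1) m
  rw [poch_succ_right, poch_succ_left y]
  ring

/-- Theorem A.4: for a positive integer `α`, the Krall–Laguerre–Koornwinder polynomials
`q_n = L_n^α + β_n L_{n-1}^α`, with `β_n = -γ_{n+1}/γ_n` and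
`γ_n = 1 + M·n(n+1)⋯(n+α-1)`, are common eigenfunctions of the differential operator
`D = P₁(D_α) + (d/dx) P₂(D_α)` of order `2α+2`. -/
theorem stmt19 (A : ℕ) (hA : 1 ≤ A) (M : ℝ)
    (γ : ℕ → ℝ) (hγ : ∀ n : ℕ, γ n = 1 + M * ∏ i ∈ Finset.range A, ((n : ℝ) + i))
    (hγnz : ∀ n : ℕ, 1 ≤ n → γ n ≠ 0)
    (β : ℕ → ℝ) (hβ : ∀ n : ℕ, 1 ≤ n → β n = -(γ (n+1) / γ n))
    (q : ℕ → ℝ[X]) (hq0 : q 0 = 1)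
    (hq : ∀ n : ℕ, q (n+1) = laguerre (A : ℝ) (n+1) + C (β (n+1)) * laguerre (A : ℝ) n)
    (lam : ℕ → ℝ)
    (hlam : ∀ n : ℕ, lam n = (n : ℝ)
      + M / ((A : ℝ) + 1) * ∏ i ∈ Finset.range (A+1), ((n : ℝ) + i))
    (P₁ P₂ : ℝ[X])
    (hP₁ : P₁ = -X + C (M / ((A : ℝ) + 1)) * ∏ i ∈ Finset.range (A+1), (-X + C (i : ℝ)))
    (hP₂ : P₂ = 1 + C M * ∏ i ∈ Finset.range A, (-X + C ((i : ℝ) + 1)))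
    (Dα : Module.End ℝ ℝ[X])
    (hDα : ∀ f : ℝ[X],
      Dα f = X * derivative (derivative f) + (C ((A : ℝ)+1) - X) * derivative f)
    (D : Module.End ℝ ℝ[X])
    (hD : D = aeval Dα P₁ + (derivative : ℝ[X] →ₗ[ℝ] ℝ[X]) * aeval Dα P₂) :
    ∀ n : ℕ, D (q n) = lam n • q n := by
  have eig (P : ℝ[X]) (n : ℕ) :
      aeval Dα P (laguerre A n) = P.eval (-(n : ℝ)) • laguerre A n := by
    have h : Dα (laguerre A n) = (-(n : ℝ)) • laguerre A n := by
      rw [hDα, laguerre_differential_equation]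
    have hmem : laguerre (A : ℝ) n ∈ Module.End.eigenspace Dα (-(n : ℝ)) :=
      Module.End.mem_eigenspace_iff.mpr h
    by_cases h0 : laguerre (A : ℝ) n = 0
    · simp [h0]
    · exact Module.End.aeval_apply_of_hasEigenvector ⟨hmem, h0⟩
  have eval₁ (n : ℕ) : P₁.eval (-(n : ℝ)) = lam n := by
    simp [hP₁, hlam, eval_prod]
  have eval₂ (n : ℕ) : P₂.eval (-(n : ℝ)) = γ (n + 1) := by
    simp [hP₂, hγ, eval_prod, add_assoc, add_comm (1 : ℝ)]
  have hDL (n : ℕ) : D (laguerre A n) =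
      lam n • laguerre A n + γ (n + 1) • derivative (laguerre (A : ℝ) n) := by
    rw [hD, LinearMap.add_apply, Module.End.mul_apply, eig, eig, eval₁, eval₂, map_smul]
  rintro (_ | n)
  · rw [hq0, ← laguerre_zero (A : ℝ), hDL, laguerre_zero]
    simp
  · have hdiff : lam (n + 1) - lam n = γ (n + 1) := by
      have h := prod_range_add_succ_sub n A
      have hA' : (A : ℝ) + 1 ≠ 0 := by positivity
      rw [hlam, hlam, hγ]
      push_cast
      field_simp
      linear_combination M * h
    have hβγ : β (n + 1) * γ (n + 1) = -γ (n + 2) := by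
      have := hγnz (n + 1) (by omega)
      rw [hβ (n + 1) (by omega)]
      field_simp
    rw [hq, ← smul_eq_C_mul, map_add, map_smul, hDL, hDL, derivative_laguerre_succ]
    have e : lam n = lam (n + 1) - γ (n + 1) := by rw [← hdiff]; ring
    have e' : γ (n + 1 + 1) = -(β (n + 1) * γ (n + 1)) := by rw [hβγ, neg_neg]
    rw [e, e']
    module
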